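/- arXiv:1205.3937 — 2 statements merged into one kernel-verified Lean document; each statement's English description precedes it below -/
import Mathlib

section
/- For any finite set A ⊆ ℝ with 0, ±1 ∉ A, the following hold: |A|^{11} / |A(A+1)|^{5} ≤ C · E_{1.5}(A) · E_{1.5}(A+1) for an absolute constant C. -/
open Finset

/-- `E_{1.5}(X)`: sum over products `s` of (number of representations `s = x·y`)^{3/2}. -/
noncomputable def E₁₅ (X : Finset ℝ) : ℝ :=
  ∑ s ∈ Finset.image₂ (· * ·) X X,
    (((X ×ˢ X).filter (fun q => q.1 * q.2 = s)).card : ℝ) ^ ((3 : ℝ) / 2)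

lemma cellFun (X : Finset ℝ) (r : ℕ) (hr : 0 < r) : ∃ f : ℝ → ℕ, Monotone f ∧
    (∀ x ∈ X, f x < r) ∧ ∀ i, #(X.filter fun x => f x = i) ≤ #X / r + 1 := by
  have hmono : Monotone (fun x : ℝ => #(X.filter fun z => z < x)) := by
    intro x y hxy
    apply Finset.card_le_card
    intro z hz
    simp only [mem_filter] at hz ⊢
    exact ⟨hz.1, hz.2.trans_le hxy⟩
  have hstrict : ∀ x ∈ X, ∀ y, x < y → #(X.filter fun z => z < x) < #(X.filter fun z => z < y) := by
    intro x hx y hxy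
    apply Finset.card_lt_card
    rw [Finset.ssubset_iff_of_subset]
    · exact ⟨x, by simp [hx, hxy], by simp⟩
    · intro z hz
      simp only [mem_filter] at hz ⊢
      exact ⟨hz.1, hz.2.trans hxy⟩
  refine ⟨fun x => #(X.filter fun z => z < x) / (#X / r + 1), ?_, ?_, ?_⟩
  · intro x y hxy
    exact Nat.div_le_div_right (hmono hxy)
  · intro x hx
    rw [Nat.div_lt_iff_lt_mul (by positivity)]
    have h1 : #(X.filter fun z => z < x) < #X := by
      apply Finset.card_lt_card
      rw [Finset.ssubset_iff_of_subset (Finset.filter_subset _ _)]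
      exact ⟨x, hx, by simp⟩
    have h2 := Nat.lt_mul_div_succ (#X) hr
    exact h1.trans h2
  · intro i
    set w := #X / r + 1 with hw
    have hw0 : 0 < w := Nat.succ_pos _
    have : #(X.filter fun x => #(X.filter fun z => z < x) / w = i) ≤ #(Finset.Ico (i * w) (i * w + w)) := by
      apply Finset.card_le_card_of_injOn (fun x : ℝ => #(X.filter fun z => z < x))
      · intro x hx
        simp only [coe_filter, Set.mem_ofPred_eq] at hx
        have := (Nat.div_eq_iff hw0).1 hx.2
        simp only [coe_Ico, Set.mem_Ico]
        omega
      · intro x hx y hy hxy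
        simp only [coe_filter, Set.mem_ofPred_eq] at hx hy
        by_contra hne
        rcases lt_or_gt_of_ne hne with h | h
        · exact absurd hxy (hstrict x hx.1 y h).ne
        · exact absurd hxy (hstrict y hy.1 x h).ne'
    simpa using this

lemma pairs_bound (X : Finset ℝ) (f : ℝ → ℕ) (w : ℕ)
    (h : ∀ i, #(X.filter fun x => f x = i) ≤ w) :
    #((X ×ˢ X).filter fun p => f p.1 = f p.2) ≤ #X * w := by
  rw [Finset.card_filter, Finset.sum_product, ← smul_eq_mul]
  apply Finset.sum_le_card_nsmul
  intro x _
  rw [← Finset.card_filter]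
  simpa [eq_comm] using h (f x)

lemma collide {α β : Type*} [DecidableEq α] [DecidableEq β] (K : Finset α) (φ : α → β) :
    #K ≤ #(K.image φ) + #((K ×ˢ K).filter fun p => p.1 ≠ p.2 ∧ φ p.1 = φ p.2) := by
  have h : ∀ c : K.image φ, ∃ y ∈ K, φ y = c := fun c => Finset.mem_image.1 c.2
  choose g hgK hg using h
  set R := Finset.univ.image g
  have hR : #R ≤ #(K.image φ) := by
    have h5 := Finset.card_image_le (s := (Finset.univ : Finset (K.image φ))) (f := g)
    rwa [Finset.card_univ, Fintype.card_coe] at h5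
  have h2 : #(K \ R) ≤ #((K ×ˢ K).filter fun p => p.1 ≠ p.2 ∧ φ p.1 = φ p.2) := by
    apply Finset.card_le_card_of_injOn (fun y => (y, if h : φ y ∈ K.image φ then g ⟨φ y, h⟩ else y))
    · intro y hy
      simp only [coe_sdiff, Set.mem_sdiff, mem_coe] at hy
      have hy' : φ y ∈ K.image φ := Finset.mem_image_of_mem _ hy.1
      simp only [hy', dite_true, coe_filter, mem_product, Set.mem_ofPred_eq]
      refine ⟨⟨hy.1, hgK _⟩, ?_, (hg ⟨φ y, hy'⟩).symm⟩
      intro he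
      exact hy.2 (he ▸ Finset.mem_image_of_mem g (Finset.mem_univ _))
    · intro y _ z _ h
      exact (Prod.mk.inj h).1
  have h3 := Finset.card_le_card_sdiff_add_card (s := K) (t := R)
  omega

lemma chain_cells (K : Finset ℝ) (f g : ℝ → ℕ) (r : ℕ) (hg : Monotone g)
    (hf : Monotone f ∨ Antitone f) (hfr : ∀ y ∈ K, f y < r) (hgr : ∀ y ∈ K, g y < r) :
    #(K.image fun y => (f y, g y)) ≤ 2 * r := by
  rcases hf with hf | hf
  · have : #(K.image fun y => (f y, g y)) ≤ #(Finset.range (2 * r)) := by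
      apply Finset.card_le_card_of_injOn (fun p => p.1 + p.2)
      · intro p hp
        simp only [coe_image, Set.mem_image, mem_coe] at hp
        obtain ⟨y, hy, rfl⟩ := hp
        have := hfr y hy
        have := hgr y hy
        simp; omega
      · intro p hp q hq h
        simp only [coe_image, Set.mem_image, mem_coe] at hp hq
        obtain ⟨y, hy, rfl⟩ := hp
        obtain ⟨z, hz, rfl⟩ := hq
        simp only [Prod.mk.injEq] at h ⊢
        rcases le_total y z with h1 | h1
        · have := hf h1
          have := hg h1
          omega
        · have := hf h1
          have := hg h1
          omega
    simpa using this
  · have : #(K.image fun y => (f y, g y)) ≤ #(Finset.range (2 * r)) := by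
      apply Finset.card_le_card_of_injOn (fun p => p.1 + (r - p.2))
      · intro p hp
        simp only [coe_image, Set.mem_image, mem_coe] at hp
        obtain ⟨y, hy, rfl⟩ := hp
        have := hfr y hy
        have := hgr y hy
        simp; omega
      · intro p hp q hq h
        simp only [coe_image, Set.mem_image, mem_coe] at hp hq
        obtain ⟨y, hy, rfl⟩ := hp
        obtain ⟨z, hz, rfl⟩ := hq
        have := hgr y hy
        have := hgr z hz
        simp only [Prod.mk.injEq] at h ⊢
        rcases le_total y z with h1 | h1
        · have := hf h1
          have := hg h1
          omega
        · have := hf h1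
          have := hg h1
          omega
    simpa using this

lemma rich_lines (X Y : Finset ℝ) (L : Finset (ℝ × ℝ)) (r : ℕ) (hr : 0 < r)
    (hm : ∀ l ∈ L, l.1 ≠ 0)
    (hk : ∀ l ∈ L, 4 * r ≤ #(Y.filter fun y => l.1 * y + l.2 ∈ X)) :
    #L * r ^ 3 ≤ 2 * #X ^ 2 * #Y ^ 2 := by
  rcases L.eq_empty_or_nonempty with rfl | ⟨l0, hl0⟩
  · simp
  obtain ⟨f, hfm, hfr, hfw⟩ := cellFun X r hr
  obtain ⟨g, hgm, hgr, hgw⟩ := cellFun Y r hr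
  have hY : r ≤ #Y := by
    have := (hk l0 hl0).trans (Finset.card_filter_le _ _)
    omega
  have hX : r ≤ #X := by
    have h1 : #(Y.filter fun y => l0.1 * y + l0.2 ∈ X) ≤ #X := by
      apply Finset.card_le_card_of_injOn (fun y => l0.1 * y + l0.2)
      · intro y hy
        simp only [coe_filter, Set.mem_ofPred_eq] at hy
        exact hy.2
      · intro y _ z _ h
        have h' : l0.1 * y = l0.1 * z := by simpa using h
        exact mul_left_cancel₀ (hm l0 hl0) h'
    have := hk l0 hl0
    omega
  set PX := (X ×ˢ X).filter fun p => f p.1 = f p.2 with hPX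
  set PY := (Y ×ˢ Y).filter fun p => g p.1 = g p.2 with hPY
  have hPXc := pairs_bound X f _ hfw
  have hPYc := pairs_bound Y g _ hgw
  let K : ℝ × ℝ → Finset ℝ := fun l => Y.filter fun y => l.1 * y + l.2 ∈ X
  let Q : ℝ × ℝ → Finset (ℝ × ℝ) := fun l => (K l ×ˢ K l).filter
    fun p => p.1 ≠ p.2 ∧ (f (l.1 * p.1 + l.2), g p.1) = (f (l.1 * p.2 + l.2), g p.2)
  have hQ : ∀ l ∈ L, 2 * r ≤ #(Q l) := by
    intro l hl
    have h1 := collide (K l) (fun y => (f (l.1 * y + l.2), g y))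
    have h2 := chain_cells (K l) (fun y => f (l.1 * y + l.2)) g r hgm (by
      rcases lt_or_gt_of_ne (hm l hl) with h | h
      · right
        intro y z hyz
        apply hfm
        nlinarith
      · left
        intro y z hyz
        apply hfm
        nlinarith) (by
        intro y hy
        exact hfr _ (Finset.mem_filter.1 hy).2) (by
        intro y hy
        exact hgr _ (Finset.mem_filter.1 hy).1)
    have h3 : 4 * r ≤ #(K l) := hk l hl
    change _ ≤ _ + #(Q l) at h1
    omega
  have hsum : #L * (2 * r) ≤ #(L.sigma Q) := by
    rw [Finset.card_sigma, ← smul_eq_mul]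
    exact Finset.card_nsmul_le_sum _ _ _ hQ
  have hinj : #(L.sigma Q) ≤ #(PX ×ˢ PY) := by
    apply Finset.card_le_card_of_injOn
      (fun t => ((t.1.1 * t.2.1 + t.1.2, t.1.1 * t.2.2 + t.1.2), t.2))
    · rintro ⟨l, y, z⟩ ht
      simp only [coe_sigma, Set.mem_sigma_iff, mem_coe, Q, K, mem_filter, mem_product,
        Prod.mk.injEq] at ht
      simp only [coe_product, Set.mem_prod, mem_coe, hPX, hPY, mem_filter, mem_product]
      tauto
    · rintro ⟨⟨m, b⟩, y, z⟩ ht ⟨⟨m', b'⟩, y', z'⟩ ht' h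
      simp only [coe_sigma, Set.mem_sigma_iff, mem_coe, Q, K, mem_filter, mem_product] at ht ht'
      simp only [Prod.mk.injEq] at h
      obtain ⟨⟨h1, h2⟩, rfl, rfl⟩ := h
      have hne : y - z ≠ 0 := sub_ne_zero.2 ht.2.2.1
      have hmm : m = m' := by
        apply mul_right_cancel₀ hne
        linarith
      subst hmm
      have : b = b' := by linarith
      subst this
      rfl
  rw [Finset.card_product] at hinj
  have hwX : r * (#X / r + 1) ≤ 2 * #X := by
    have := Nat.mul_div_le (#X) r
    rw [mul_add]; omega
  have hwY : r * (#Y / r + 1) ≤ 2 * #Y := by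
    have := Nat.mul_div_le (#Y) r
    rw [mul_add]; omega
  have h1 : #L * (2 * r) ≤ (#X * (#X / r + 1)) * (#Y * (#Y / r + 1)) :=
    hsum.trans (hinj.trans (Nat.mul_le_mul hPXc hPYc))
  have h2 : 2 * (#L * r ^ 3) ≤ 2 * (2 * #X ^ 2 * #Y ^ 2) := by
    calc 2 * (#L * r ^ 3) = (#L * (2 * r)) * r ^ 2 := by ring
      _ ≤ (#X * (#X / r + 1)) * (#Y * (#Y / r + 1)) * r ^ 2 := Nat.mul_le_mul_right _ h1
      _ = #X * #Y * ((r * (#X / r + 1)) * (r * (#Y / r + 1))) := by ring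
      _ ≤ #X * #Y * ((2 * #X) * (2 * #Y)) := Nat.mul_le_mul_left _ (Nat.mul_le_mul hwX hwY)
      _ = _ := by ring
  omega

/-- number of product representations -/
noncomputable def rep (X : Finset ℝ) (s : ℝ) : ℕ := #((X ×ˢ X).filter (fun q => q.1 * q.2 = s))

lemma level_bound (X U : Finset ℝ) (ε : ℝ) (hε : ε ≠ 0) (h0 : (0 : ℝ) ∉ X)
    (hU : ∀ a ∈ X, ∀ c ∈ X, a * (c + ε) ∈ U) (hc : #X ≤ #U) (k : ℕ) (hk : 0 < k) :
    k ^ 3 * #((image₂ (· * ·) X X).filter fun s => k ≤ rep X s) ≤ 1024 * #U ^ 2 * #X := by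
  set T := (image₂ (· * ·) X X).filter fun s => k ≤ rep X s with hT
  have hX0 : ∀ x ∈ X, x ≠ 0 := fun x hx h => h0 (h ▸ hx)
  have hTc : #T ≤ #X * #X := (Finset.card_filter_le _ _).trans (Finset.card_image₂_le _ _ _)
  rcases lt_or_ge k 4 with hk4 | hk4
  · have : k ^ 3 ≤ 1024 := by interval_cases k <;> norm_num
    have hUX : #X ≤ #U ^ 2 := by nlinarith
    calc k ^ 3 * #T ≤ 1024 * (#X * #X) := Nat.mul_le_mul this hTc
      _ ≤ 1024 * (#U ^ 2 * #X) := by gcongr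
      _ = _ := by ring
  · obtain ⟨r, hr, h4r, hkr⟩ : ∃ r, 0 < r ∧ 4 * r ≤ k ∧ k ≤ 8 * r := ⟨k / 4, by omega⟩
    have hTs : ∀ s ∈ T, s ≠ 0 := by
      intro s hs
      obtain ⟨a, ha, b, hb, rfl⟩ := Finset.mem_image₂.1 (Finset.mem_filter.1 hs).1
      exact mul_ne_zero (hX0 a ha) (hX0 b hb)
    set L := (T ×ˢ X).image fun p => (p.2 * p.1, p.2 * ε) with hL
    have hLc : #L = #T * #X := by
      rw [hL, Finset.card_image_of_injOn, Finset.card_product]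
      rintro ⟨s, a⟩ hs ⟨s', a'⟩ hs' h
      simp only [coe_product, Set.mem_prod, mem_coe] at hs hs'
      simp only [Prod.mk.injEq] at h
      have ha : a = a' := mul_right_cancel₀ hε h.2
      subst ha
      have := mul_left_cancel₀ (hX0 a hs.2) h.1
      rw [this]
    have key := rich_lines U (X.image (·⁻¹)) L r hr (by
      intro l hl
      obtain ⟨⟨s, a⟩, hs, rfl⟩ := Finset.mem_image.1 hl
      rw [Finset.mem_product] at hs
      exact mul_ne_zero (hX0 a hs.2) (hTs s hs.1)) (by
      intro l hl
      obtain ⟨⟨s, a⟩, hs, rfl⟩ := Finset.mem_image.1 hl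
      rw [Finset.mem_product] at hs
      have h1 : k ≤ rep X s := (Finset.mem_filter.1 hs.1).2
      refine h4r.trans (h1.trans ?_)
      apply Finset.card_le_card_of_injOn (fun q => q.2⁻¹)
      · rintro ⟨c, d⟩ hq
        simp only [coe_filter, mem_product, Set.mem_ofPred_eq] at hq
        have hd := hX0 d hq.1.2
        simp only [coe_filter, Set.mem_ofPred_eq]
        refine ⟨Finset.mem_image_of_mem _ hq.1.2, ?_⟩
        have : a * s * d⁻¹ + a * ε = a * (c + ε) := by
          rw [← hq.2]; field_simp
        rw [this]
        exact hU a hs.2 c hq.1.1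
      · rintro ⟨c, d⟩ hq ⟨c', d'⟩ hq' h
        simp only [coe_filter, mem_product, Set.mem_ofPred_eq] at hq hq'
        have hd : d = d' := inv_injective h
        subst hd
        have := mul_right_cancel₀ (hX0 d hq.1.2) (hq.2.trans hq'.2.symm)
        rw [this])
    rw [hLc, Finset.card_image_of_injective _ inv_injective] at key
    rcases Nat.eq_zero_or_pos (#X) with hx | hx
    · have : #T = 0 := by simpa [hx] using hTc
      simp [this]
    have key2 : #T * r ^ 3 ≤ 2 * #U ^ 2 * #X := by
      apply Nat.le_of_mul_le_mul_right _ hx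
      calc #T * r ^ 3 * #X = #T * #X * r ^ 3 := by ring
        _ ≤ _ := key
        _ = _ := by ring
    calc k ^ 3 * #T ≤ (8 * r) ^ 3 * #T := by gcongr
      _ = 512 * (#T * r ^ 3) := by ring
      _ ≤ 512 * (2 * #U ^ 2 * #X) := by gcongr
      _ = _ := by ring

lemma high_part (S : Finset ℝ) (r : ℝ → ℕ) (D : ℝ)
    (h : ∀ k : ℕ, 0 < k → (k : ℝ) ^ 3 * (#(S.filter fun s => k ≤ r s) : ℝ) ≤ D) (hD : 0 < D)
    (x : ℝ) (hx : 0 < x) :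
    ∑ s ∈ S.filter (fun s => x ≤ r s), (r s : ℝ) ^ 2 ≤ 16 * D / x := by
  set S' := S.filter (fun s => x ≤ r s) with hS'
  set N := S.sup r + 1 with hN
  have hc : 0 < ⌈x / 2⌉₊ := Nat.ceil_pos.2 (by positivity)
  obtain ⟨k0, hk0⟩ : ∃ k0, ⌈x / 2⌉₊ = k0 + 1 := ⟨⌈x / 2⌉₊ - 1, by omega⟩
  have hxk : x / 2 ≤ (k0 : ℝ) + 1 := by
    have := Nat.le_ceil (x / 2)
    rw [hk0] at this
    exact_mod_cast this
  have h1 : ∀ s ∈ S', (r s : ℝ) ^ 2 ≤ 4 * ∑ k ∈ Ioo k0 N, if k ≤ r s then (k : ℝ) else 0 := by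
    intro s hs
    obtain ⟨hsS, hsx⟩ := Finset.mem_filter.1 hs
    have hrN : r s < N := Nat.lt_succ_of_le (Finset.le_sup (f := r) hsS)
    generalize r s = n at *
    set m := (n + 1) / 2 with hm
    have hm1 : n ≤ 2 * m := by omega
    have hm2 : n ≤ 2 * (n + 1 - m) := by omega
    have hmk : k0 + 1 ≤ m := by
      rw [← hk0, Nat.ceil_le]
      have : (n : ℝ) ≤ 2 * m := by exact_mod_cast hm1
      linarith
    rw [← Finset.sum_filter]
    have hsub : Icc m n ⊆ (Ioo k0 N).filter fun k => k ≤ n := by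
      intro k hk
      simp only [mem_Icc, mem_filter, mem_Ioo] at hk ⊢
      omega
    have h2 : ∑ k ∈ Icc m n, (k : ℝ) ≤ ∑ k ∈ (Ioo k0 N).filter (fun k => k ≤ n), (k : ℝ) :=
      Finset.sum_le_sum_of_subset_of_nonneg hsub (fun _ _ _ => by positivity)
    have h3 : ((n + 1 - m : ℕ) : ℝ) * m ≤ ∑ k ∈ Icc m n, (k : ℝ) := by
      have := Finset.card_nsmul_le_sum (Icc m n) (fun k : ℕ => (k : ℝ)) m (by
        intro k hk
        exact_mod_cast (Finset.mem_Icc.1 hk).1)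
      simpa using this
    have h4 : (n : ℝ) * n ≤ (2 * m) * (2 * (n + 1 - m : ℕ)) := by
      exact_mod_cast Nat.mul_le_mul hm1 hm2
    nlinarith
  have h2 : ∀ k ∈ Ioo k0 N, (∑ s ∈ S', if k ≤ r s then (k : ℝ) else 0) ≤ D * ((k : ℝ) ^ 2)⁻¹ := by
    intro k hk
    have hk0' : 0 < k := by
      have := (Finset.mem_Ioo.1 hk).1
      omega
    have hkr : (0 : ℝ) < k := by exact_mod_cast hk0'
    rw [← Finset.sum_filter, Finset.sum_const, nsmul_eq_mul]
    have h3 : #(S'.filter fun s => k ≤ r s) ≤ #(S.filter fun s => k ≤ r s) :=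
      Finset.card_le_card (Finset.filter_subset_filter _ (Finset.filter_subset _ _))
    have h3' : (#(S'.filter fun s => k ≤ r s) : ℝ) ≤ #(S.filter fun s => k ≤ r s) := by
      exact_mod_cast h3
    have h4 := h k hk0'
    rw [← div_eq_mul_inv, le_div_iff₀ (by positivity)]
    calc _ = (k : ℝ) ^ 3 * (#(S'.filter fun s => k ≤ r s) : ℝ) := by ring
      _ ≤ (k : ℝ) ^ 3 * (#(S.filter fun s => k ≤ r s) : ℝ) := by gcongr
      _ ≤ D := h4
  calc ∑ s ∈ S', (r s : ℝ) ^ 2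
      ≤ ∑ s ∈ S', 4 * ∑ k ∈ Ioo k0 N, (if k ≤ r s then (k : ℝ) else 0) := Finset.sum_le_sum h1
    _ = 4 * ∑ k ∈ Ioo k0 N, ∑ s ∈ S', (if k ≤ r s then (k : ℝ) else 0) := by
        rw [← Finset.mul_sum, Finset.sum_comm]
    _ ≤ 4 * ∑ k ∈ Ioo k0 N, D * ((k : ℝ) ^ 2)⁻¹ := by
        gcongr with k hk
        exact h2 k hk
    _ = 4 * D * ∑ k ∈ Ioo k0 N, ((k : ℝ) ^ 2)⁻¹ := by
        rw [← Finset.mul_sum]; ring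
    _ ≤ 4 * D * (2 / ((k0 : ℝ) + 1)) := by
        gcongr
        exact sum_Ioo_inv_sq_le k0 N
    _ ≤ 4 * D * (2 / (x / 2)) := by gcongr
    _ = 16 * D / x := by field_simp; norm_num

lemma moment (S : Finset ℝ) (r : ℝ → ℕ) (D : ℝ)
    (h : ∀ k : ℕ, 0 < k → (k : ℝ) ^ 3 * (#(S.filter fun s => k ≤ r s) : ℝ) ≤ D) (hD : 0 < D) :
    (∑ s ∈ S, (r s : ℝ) ^ 2) ^ 3 ≤ 17 ^ 3 * D * (∑ s ∈ S, (r s : ℝ) ^ ((3 : ℝ) / 2)) ^ 2 := by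
  set E := ∑ s ∈ S, (r s : ℝ) ^ ((3 : ℝ) / 2) with hE
  have hE0 : 0 ≤ E := Finset.sum_nonneg fun _ _ => by positivity
  rcases hE0.eq_or_lt with h0 | hpos
  · have h1 : ∀ s ∈ S, (r s : ℝ) ^ ((3 : ℝ) / 2) = 0 :=
      (Finset.sum_eq_zero_iff_of_nonneg (fun _ _ => by positivity)).1 h0.symm
    have h2 : ∑ s ∈ S, (r s : ℝ) ^ 2 = 0 := by
      apply Finset.sum_eq_zero
      intro s hs
      have := (Real.rpow_eq_zero (by positivity) (by norm_num)).1 (h1 s hs)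
      simp [this]
    rw [h2, ← h0]; simp
  · obtain ⟨u, hu, hu3⟩ : ∃ u : ℝ, 0 < u ∧ u ^ 3 = D / E := by
      refine ⟨(D / E) ^ ((1 : ℝ) / 3), by positivity, ?_⟩
      rw [← Real.rpow_natCast, ← Real.rpow_mul (by positivity)]
      norm_num
    have hDu : D = u ^ 3 * E := by rw [hu3]; field_simp
    have hhigh := high_part S r D h hD (u ^ 2) (by positivity)
    have hlow : ∑ s ∈ S.filter (fun s => ¬ (u ^ 2 ≤ r s)), (r s : ℝ) ^ 2 ≤ u * E := by
      calc _ ≤ ∑ s ∈ S.filter (fun s => ¬ (u ^ 2 ≤ r s)), u * (r s : ℝ) ^ ((3 : ℝ) / 2) := by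
            apply Finset.sum_le_sum
            intro s hs
            have h1 := (Finset.mem_filter.1 hs).2
            push Not at h1
            have h2 : (r s : ℝ) ^ 2 = (r s : ℝ) ^ ((1 : ℝ) / 2) * (r s : ℝ) ^ ((3 : ℝ) / 2) := by
              rw [← Real.rpow_natCast, ← Real.rpow_add_of_nonneg (by positivity) (by norm_num)
                (by norm_num)]
              norm_num
            rw [h2]
            gcongr
            rw [← Real.sqrt_eq_rpow]
            exact (Real.sqrt_le_left hu.le).2 h1.le
        _ ≤ ∑ s ∈ S, u * (r s : ℝ) ^ ((3 : ℝ) / 2) :=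
            Finset.sum_le_sum_of_subset_of_nonneg (Finset.filter_subset _ _)
              (fun _ _ _ => by positivity)
        _ = u * E := by rw [← Finset.mul_sum]
    have h3 : 16 * D / u ^ 2 = 16 * (u * E) := by rw [hDu]; field_simp
    have hall : ∑ s ∈ S, (r s : ℝ) ^ 2 ≤ 17 * (u * E) := by
      rw [← Finset.sum_filter_add_sum_filter_not S (fun s => u ^ 2 ≤ (r s : ℝ))]
      linarith
    calc (∑ s ∈ S, (r s : ℝ) ^ 2) ^ 3 ≤ (17 * (u * E)) ^ 3 := by gcongr
      _ = _ := by rw [hDu]; ring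

open scoped Combinatorics.Additive

/-- number of quotient representations -/
noncomputable def qrep (X : Finset ℝ) (s : ℝ) : ℕ := #((X ×ˢ X).filter (fun q => q.1 / q.2 = s))

lemma mulEnergy_quot (A B Q : Finset ℝ) (hA : (0 : ℝ) ∉ A) (hB : (0 : ℝ) ∉ B)
    (hQ : ∀ a ∈ A, ∀ b ∈ A, a / b ∈ Q) :
    mulEnergy A B = ∑ q ∈ Q, qrep A q * qrep B q := by
  have hA0 : ∀ x ∈ A, x ≠ 0 := fun x hx h => hA (h ▸ hx)
  have hB0 : ∀ x ∈ B, x ≠ 0 := fun x hx h => hB (h ▸ hx)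
  unfold mulEnergy
  rw [Finset.card_eq_sum_card_fiberwise (f := fun x => x.1.1 / x.1.2) (t := Q)]
  · apply Finset.sum_congr rfl
    intro q _
    have h1 : qrep B q = #((B ×ˢ B).filter (fun p => p.2 / p.1 = q)) := by
      unfold qrep
      apply Finset.card_equiv (Equiv.prodComm _ _)
      rintro ⟨a, b⟩
      simp [and_comm]
    rw [h1, qrep, ← Finset.card_product]
    congr 1
    ext ⟨⟨a, a'⟩, b, b'⟩
    simp only [mem_filter, mem_product]
    constructor
    · rintro ⟨⟨⟨⟨ha, ha'⟩, hb, hb'⟩, h⟩, hq⟩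
      refine ⟨⟨⟨ha, ha'⟩, hq⟩, ⟨hb, hb'⟩, ?_⟩
      rw [← hq, div_eq_div_iff (hB0 b hb) (hA0 a' ha')]
      linarith
    · rintro ⟨⟨⟨ha, ha'⟩, hq⟩, ⟨hb, hb'⟩, hq'⟩
      refine ⟨⟨⟨⟨ha, ha'⟩, hb, hb'⟩, ?_⟩, hq⟩
      rw [← hq, div_eq_div_iff (hB0 b hb) (hA0 a' ha')] at hq'
      linarith
  · rintro ⟨⟨a, a'⟩, b, b'⟩ h
    have h' := Finset.mem_filter.1 (Finset.mem_coe.1 h)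
    simp only [mem_product] at h'
    exact hQ a h'.1.1.1 a' h'.1.1.2

lemma mulEnergy_cs (A B : Finset ℝ) (hA : (0 : ℝ) ∉ A) (hB : (0 : ℝ) ∉ B) :
    mulEnergy A B ^ 2 ≤ mulEnergy A A * mulEnergy B B := by
  set Q := image₂ (· / ·) A A ∪ image₂ (· / ·) B B with hQ
  have h1 : ∀ a ∈ A, ∀ b ∈ A, a / b ∈ Q := fun a ha b hb =>
    Finset.mem_union_left _ (Finset.mem_image₂_of_mem ha hb)
  have h2 : ∀ a ∈ B, ∀ b ∈ B, a / b ∈ Q := fun a ha b hb =>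
    Finset.mem_union_right _ (Finset.mem_image₂_of_mem ha hb)
  rw [mulEnergy_quot A B Q hA hB h1, mulEnergy_quot A A Q hA hA h1, mulEnergy_quot B B Q hB hB h2]
  have := Finset.sum_mul_sq_le_sq_mul_sq Q (qrep A) (qrep B)
  simpa [sq] using this

lemma mulEnergy_rep (X : Finset ℝ) :
    (mulEnergy X X : ℝ) = ∑ s ∈ image₂ (· * ·) X X, (rep X s : ℝ) ^ 2 := by
  have h := mulEnergy_eq_sum_sq' X X
  rw [h]
  push_cast
  rfl

lemma energy_bound (X U : Finset ℝ) (ε : ℝ) (hε : ε ≠ 0) (h0 : (0 : ℝ) ∉ X)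
    (hU : ∀ a ∈ X, ∀ c ∈ X, a * (c + ε) ∈ U) (hc : #X ≤ #U) (hX : 0 < #X) :
    (mulEnergy X X : ℝ) ^ 3 ≤ 17 ^ 3 * (1024 * (#U : ℝ) ^ 2 * #X) * E₁₅ X ^ 2 := by
  rw [mulEnergy_rep]
  have hU0 : 0 < #U := by omega
  apply moment
  · intro k hk
    exact_mod_cast level_bound X U ε hε h0 hU hc k hk
  · positivity

theorem stmt14 :
    ∃ C : ℝ, 0 < C ∧ ∀ A : Finset ℝ,
      (0 : ℝ) ∉ A → (1 : ℝ) ∉ A → (-1 : ℝ) ∉ A →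
      (A.card : ℝ) ^ (11 : ℕ) /
          ((Finset.image₂ (fun a b => a * (b + 1)) A A).card : ℝ) ^ (5 : ℕ) ≤
        C * E₁₅ A * E₁₅ (A.image (· + 1)) := by
  refine ⟨17 ^ 3 * 1024, by norm_num, ?_⟩
  intro A h0 _ hm1
  have hEn : ∀ X, 0 ≤ E₁₅ X := fun X => Finset.sum_nonneg fun _ _ => by positivity
  have hR : 0 ≤ 17 ^ 3 * 1024 * E₁₅ A * E₁₅ (A.image (· + 1)) := by
    have := hEn A
    have := hEn (A.image (· + 1))
    positivity
  rcases A.eq_empty_or_nonempty with hA | hA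
  · subst hA
    simpa using hR
  set U := Finset.image₂ (fun a b => a * (b + 1)) A A with hU
  set B := A.image (· + 1) with hB
  have hBc : #B = #A := Finset.card_image_of_injective _ (add_left_injective 1)
  have hB0 : (0 : ℝ) ∉ B := by
    intro h
    obtain ⟨a, ha, h⟩ := Finset.mem_image.1 h
    have : a = -1 := by linarith
    exact hm1 (this ▸ ha)
  have hAU : #A ≤ #U := by
    obtain ⟨a, ha⟩ := hA
    apply Finset.card_le_card_of_injOn (fun b => a * (b + 1))
    · intro b hb
      exact Finset.mem_image₂_of_mem ha hb
    · intro b _ c _ h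
      have h' : a * (b + 1) = a * (c + 1) := h
      have := mul_left_cancel₀ (fun h => h0 (h ▸ ha)) h'
      linarith
  have hApos : 0 < #A := hA.card_pos
  have e1 := energy_bound A U 1 one_ne_zero h0
    (fun a ha c hc => Finset.mem_image₂_of_mem ha hc) hAU hApos
  have e2 := energy_bound B U (-1) (by norm_num) hB0 (by
    intro b hb c hc
    obtain ⟨a, ha, rfl⟩ := Finset.mem_image.1 hb
    obtain ⟨a', ha', rfl⟩ := Finset.mem_image.1 hc
    have : (a + 1) * (a' + 1 + -1) = a' * (a + 1) := by ring
    rw [this]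
    exact Finset.mem_image₂_of_mem ha' ha) (hBc ▸ hAU) (hBc ▸ hApos)
  rw [hBc] at e2
  have hcs := mulEnergy_cs A B h0 hB0
  have hcard : (#A ^ 2) ^ 2 ≤ #U * mulEnergy A B := by
    have h := card_sq_le_card_mul_mulEnergy A B U
    have h2 : (A ×ˢ B).filter (fun xy => xy.1 * xy.2 ∈ U) = A ×ˢ B := by
      apply Finset.filter_true_of_mem
      rintro ⟨a, b⟩ hab
      rw [Finset.mem_product] at hab
      obtain ⟨a', ha', hb⟩ := Finset.mem_image.1 hab.2
      dsimp only at hb hab ⊢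
      rw [← hb]
      exact Finset.mem_image₂_of_mem hab.1 ha'
    rw [h2, Finset.card_product, hBc, ← sq] at h
    exact h
  have hcs' : (mulEnergy A B : ℝ) ^ 2 ≤ mulEnergy A A * mulEnergy B B := by exact_mod_cast hcs
  have hcard' : ((#A : ℝ) ^ 2) ^ 2 ≤ #U * mulEnergy A B := by exact_mod_cast hcard
  have hn : (0 : ℝ) < #A := by exact_mod_cast hApos
  have hM : (0 : ℝ) < #U := by exact_mod_cast hApos.trans_le hAU
  have pA := hEn A
  have pB := hEn B
  generalize E₁₅ A = EA at *
  generalize E₁₅ B = EB at *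
  generalize (mulEnergy A B : ℝ) = F at *
  have hA' : (0 : ℝ) ≤ mulEnergy A A := by positivity
  have hB' : (0 : ℝ) ≤ mulEnergy B B := by positivity
  generalize (mulEnergy A A : ℝ) = FA at *
  generalize (mulEnergy B B : ℝ) = FB at *
  generalize (#A : ℝ) = n at *
  generalize (#U : ℝ) = M at *
  rw [div_le_iff₀ (by positivity)]
  have s1 : (n ^ 12) ^ 2 ≤ (17 ^ 3 * 1024 * EA * EB * M ^ 5 * n) ^ 2 := by
    calc (n ^ 12) ^ 2 = ((n ^ 2) ^ 2) ^ 6 := by ring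
      _ ≤ (M * F) ^ 6 := by gcongr
      _ = M ^ 6 * (F ^ 2) ^ 3 := by ring
      _ ≤ M ^ 6 * (FA * FB) ^ 3 := by gcongr
      _ = M ^ 6 * (FA ^ 3 * FB ^ 3) := by ring
      _ ≤ M ^ 6 * ((17 ^ 3 * (1024 * M ^ 2 * n) * EA ^ 2) * (17 ^ 3 * (1024 * M ^ 2 * n) * EB ^ 2)) := by
          gcongr
      _ = _ := by ring
  have s2 := (pow_le_pow_iff_left₀ (by positivity) (by positivity) two_ne_zero).1 s1
  have s3 : n ^ 11 * n ≤ (17 ^ 3 * 1024 * EA * EB * M ^ 5) * n := by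
    calc n ^ 11 * n = n ^ 12 := by ring
      _ ≤ _ := s2
  exact le_of_mul_le_mul_right s3 hn
end

section
/- For any finite set A ⊆ ℝ with 0, ±1 ∉ A, E_2(A, A(A+1)) ≤ C |A(A+1)|^{5/2} and E_2(A+1, A(A+1)) ≤ C |A(A+1)|^{5/2}, where E_2(X,Y) is the number of quadruples (x,x',y,y') ∈ X × X × Y × Y with xy = x'y'. -/
open Finset

/-- `E_2(X,Y)`: number of quadruples `(x,x',y,y') ∈ X × X × Y × Y` with `x·y = x'·y'`. -/
noncomputable def E₂ (X Y : Finset ℝ) : ℕ :=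
  (((X ×ˢ X) ×ˢ (Y ×ˢ Y)).filter (fun q => q.1.1 * q.2.1 = q.1.2 * q.2.2)).card

open Classical in
lemma pairs_card {α β : Type*} (P : Finset α) (c : α → β) :
    ((P ×ˢ P).filter (fun z => c z.1 = c z.2)).card
      = ∑ b ∈ P.image c, (P.filter (fun a => c a = b)).card ^ 2 := by
  rw [Finset.card_eq_sum_card_fiberwise (f := fun z : α × α => c z.1) (t := P.image c)]
  · refine Finset.sum_congr rfl fun b _ => ?_
    rw [sq, ← Finset.card_product]
    congr 1
    ext ⟨x, y⟩
    simp only [mem_filter, mem_product]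
    constructor
    · rintro ⟨⟨⟨h1, h2⟩, h3⟩, h4⟩
      exact ⟨⟨h1, h4⟩, h2, h3 ▸ h4⟩
    · rintro ⟨⟨h1, h4⟩, h2, h5⟩
      exact ⟨⟨⟨h1, h2⟩, h4.trans h5.symm⟩, h4⟩
  · intro z hz
    simp only [coe_filter, mem_product, Set.mem_ofPred_eq] at hz
    exact Finset.mem_coe.2 (Finset.mem_image_of_mem _ hz.1.1)

open Classical in
lemma cs_pairs {α β : Type*} (P : Finset α) (c : α → β) (M : ℕ) (h : (P.image c).card ≤ M) :
    P.card ^ 2 ≤ M * ((P ×ˢ P).filter (fun z => c z.1 = c z.2)).card := by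
  rw [pairs_card]
  have h1 : P.card = ∑ b ∈ P.image c, (P.filter (fun a => c a = b)).card :=
    Finset.card_eq_sum_card_image c P
  calc P.card ^ 2 = (∑ b ∈ P.image c, (P.filter (fun a => c a = b)).card) ^ 2 := by rw [← h1]
    _ ≤ (P.image c).card * ∑ b ∈ P.image c, (P.filter (fun a => c a = b)).card ^ 2 :=
        sq_sum_le_card_mul_sum_sq
    _ ≤ _ := Nat.mul_le_mul_right _ h

/-- Refining a key by a second key with few values on each fibre. -/
lemma refine_pairs {α β γ : Type*} (P : Finset α) (k : α → γ) (c : α → β) (M : ℕ)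
    [DecidableEq β] [DecidableEq γ]
    (h : ∀ x ∈ P.image k, ((P.filter (fun a => k a = x)).image c).card ≤ M) :
    ((P ×ˢ P).filter (fun z => k z.1 = k z.2)).card ≤
      M * ((P ×ˢ P).filter (fun z => k z.1 = k z.2 ∧ c z.1 = c z.2)).card := by
  classical
  have e := pairs_card P k
  have e2 : ((P ×ˢ P).filter (fun z => k z.1 = k z.2 ∧ c z.1 = c z.2)).card
     = ∑ x ∈ P.image k, (((P.filter (fun a => k a = x)) ×ˢ (P.filter (fun a => k a = x))).filter
        (fun z => c z.1 = c z.2)).card := by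
    rw [Finset.card_eq_sum_card_fiberwise (f := fun z : α × α => k z.1) (t := P.image k)]
    · refine Finset.sum_congr rfl fun b _ => ?_
      congr 1
      ext ⟨x, y⟩
      simp only [mem_filter, mem_product]
      constructor
      · rintro ⟨⟨⟨h1, h2⟩, h3, h5⟩, h4⟩
        exact ⟨⟨⟨h1, h4⟩, h2, h3 ▸ h4⟩, h5⟩
      · rintro ⟨⟨⟨h1, h4⟩, h2, h5⟩, h6⟩
        exact ⟨⟨⟨h1, h2⟩, h4.trans h5.symm, h6⟩, h4⟩
    · intro z hz
      simp only [coe_filter, mem_product, Set.mem_ofPred_eq] at hz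
      exact Finset.mem_coe.2 (Finset.mem_image_of_mem _ hz.1.1)
  rw [e2, Finset.mul_sum]
  convert_to ∑ b ∈ P.image k, (P.filter (fun a => k a = b)).card ^ 2 ≤ _
  · convert e
  refine Finset.sum_le_sum fun x hx => ?_
  have := cs_pairs (P.filter (fun a => k a = x)) c M (by convert h x hx)
  refine le_trans (le_of_eq ?_) (this.trans (le_of_eq ?_))
  · congr!
  · congr!

lemma chain_image (U : Finset ℝ) (F G : ℝ → ℤ) (K : ℕ) (e₁ e₂ : ℤ)
    (he₁ : e₁ = 1 ∨ e₁ = -1) (he₂ : e₂ = 1 ∨ e₂ = -1)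
    (hF : Monotone fun u => e₁ * F u) (hG : Monotone fun u => e₂ * G u)
    (hF0 : ∀ u, 0 ≤ F u ∧ F u ≤ K) (hG0 : ∀ u, 0 ≤ G u ∧ G u ≤ K) :
    (U.image (fun u => (F u, G u))).card ≤ 2 * K + 1 := by
  have key : ∃ t : ℤ, ∀ u, e₁ * F u + e₂ * G u ∈ Finset.Icc t (t + 2 * K) := by
    rcases he₁ with rfl | rfl <;> rcases he₂ with rfl | rfl
    · exact ⟨0, fun u => by have := hF0 u; have := hG0 u; rw [Finset.mem_Icc]; omega⟩
    · exact ⟨-K, fun u => by have := hF0 u; have := hG0 u; rw [Finset.mem_Icc]; omega⟩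
    · exact ⟨-K, fun u => by have := hF0 u; have := hG0 u; rw [Finset.mem_Icc]; omega⟩
    · exact ⟨-(2*K), fun u => by have := hF0 u; have := hG0 u; rw [Finset.mem_Icc]; omega⟩
  obtain ⟨t, ht⟩ := key
  have : (U.image (fun u => (F u, G u))).card ≤ (Finset.Icc t (t + 2 * K)).card := by
    apply Finset.card_le_card_of_injOn (fun p => e₁ * p.1 + e₂ * p.2)
    · intro p hp
      simp only [coe_image, Set.mem_image] at hp
      obtain ⟨u, _, rfl⟩ := hp
      exact ht u
    · intro p hp q hq hpq
      simp only [coe_image, Set.mem_image] at hp hq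
      obtain ⟨u, _, rfl⟩ := hp
      obtain ⟨v, _, rfl⟩ := hq
      have h1 : e₁ * F u = e₁ * F v ∧ e₂ * G u = e₂ * G v := by
        simp only at hpq
        rcases le_total u v with huv | huv
        · have := hF huv
          have := hG huv
          simp only at *
          constructor <;> linarith
        · have := hF huv
          have := hG huv
          simp only at *
          constructor <;> linarith
      rcases he₁ with rfl | rfl <;> rcases he₂ with rfl | rfl <;>
        (ext <;> simp only <;> omega)
  refine this.trans ?_
  rw [Int.card_Icc]
  omega

/-- The cell index of `y`. -/
noncomputable def cellIdx (Y : Finset ℝ) (s : ℕ) (y : ℝ) : ℕ := (Y.filter (· < y)).card / s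

lemma cellIdx_mono (Y : Finset ℝ) (s : ℕ) : Monotone (cellIdx Y s) := by
  intro a b h
  refine Nat.div_le_div_right (Finset.card_le_card ?_)
  intro z hz
  simp only [mem_filter] at hz ⊢
  exact ⟨hz.1, hz.2.trans_le h⟩

lemma cellIdx_le (Y : Finset ℝ) (s : ℕ) (y : ℝ) : cellIdx Y s y ≤ Y.card / s :=
  Nat.div_le_div_right (Finset.card_filter_le _ _)

lemma cellIdx_fiber (Y : Finset ℝ) (s : ℕ) (hs : 0 < s) (i : ℕ) :
    (Y.filter (fun y => cellIdx Y s y = i)).card ≤ s := by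
  have : (Y.filter (fun y => cellIdx Y s y = i)).card ≤ (Finset.Ico (i * s) (i * s + s)).card := by
    apply Finset.card_le_card_of_injOn (fun y => (Y.filter (· < y)).card)
    · intro y hy
      rw [Finset.mem_coe, Finset.mem_filter, cellIdx] at hy
      have := (Nat.div_eq_iff hs).1 hy.2
      simp only [coe_Ico, Set.mem_Ico]
      omega
    · have aux : ∀ a ∈ Y, ∀ b, a < b → (Y.filter (· < a)).card < (Y.filter (· < b)).card := by
        intro a ha b hab
        apply Finset.card_lt_card
        rw [Finset.ssubset_iff_of_subset]
        · exact ⟨a, by simp [ha, hab], by simp⟩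
        · intro z hz
          simp only [mem_filter] at hz ⊢
          exact ⟨hz.1, hz.2.trans hab⟩
      intro a ha b hb hab
      simp only [coe_filter, Set.mem_ofPred_eq] at ha hb
      rcases lt_trichotomy a b with h | h | h
      · have := aux a ha.1 b h
        simp only at hab; omega
      · exact h
      · have := aux b hb.1 a h
        simp only at hab; omega
  simpa using this

lemma cell_pairs (Y : Finset ℝ) (s : ℕ) (hs : 0 < s) :
    ((Y ×ˢ Y).filter (fun z => cellIdx Y s z.1 = cellIdx Y s z.2)).card ≤ Y.card * s := by
  rw [Finset.card_eq_sum_card_fiberwise (f := fun z : ℝ × ℝ => z.1) (t := Y)]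
  · rw [← smul_eq_mul]
    apply Finset.sum_le_card_nsmul
    intro y hy
    refine le_trans ?_ (cellIdx_fiber Y s hs (cellIdx Y s y))
    apply Finset.card_le_card_of_injOn (fun z => z.2)
    · rintro ⟨a, b⟩ hz
      simp only [coe_filter, mem_filter, mem_product, Set.mem_ofPred_eq] at hz ⊢
      obtain ⟨⟨⟨h1, h2⟩, h3⟩, rfl⟩ := hz
      exact ⟨h2, h3.symm⟩
    · rintro ⟨a, b⟩ hz ⟨a', b'⟩ hz' h
      simp only [coe_filter, mem_filter, Set.mem_ofPred_eq] at hz hz' h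
      ext
      · exact hz.2.trans hz'.2.symm
      · exact h
  · rintro ⟨a, b⟩ hz
    simp only [coe_filter, mem_product, Set.mem_ofPred_eq] at hz
    exact hz.1.1

lemma E₂_eq (U Y : Finset ℝ) (hU : (0 : ℝ) ∉ U) :
    E₂ U Y = (((U ×ˢ Y) ×ˢ (U ×ˢ Y)).filter (fun z => z.1.2 / z.1.1 = z.2.2 / z.2.1)).card := by
  unfold E₂
  refine Finset.card_bij' (fun q _ => ((q.1.2, q.2.1), (q.1.1, q.2.2)))
    (fun z _ => ((z.2.1, z.1.1), (z.1.2, z.2.2))) ?_ ?_ ?_ ?_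
  · rintro ⟨⟨x, x'⟩, y, y'⟩ h
    simp only [mem_filter, mem_product] at h ⊢
    obtain ⟨⟨⟨h1, h2⟩, h3, h4⟩, h5⟩ := h
    refine ⟨⟨⟨h2, h3⟩, h1, h4⟩, ?_⟩
    rw [div_eq_div_iff (ne_of_mem_of_not_mem h2 hU) (ne_of_mem_of_not_mem h1 hU)]
    linarith
  · rintro ⟨⟨x', y⟩, x, y'⟩ h
    simp only [mem_filter, mem_product] at h ⊢
    obtain ⟨⟨⟨h2, h3⟩, h1, h4⟩, h5⟩ := h
    refine ⟨⟨⟨h1, h2⟩, h3, h4⟩, ?_⟩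
    rw [div_eq_div_iff (ne_of_mem_of_not_mem h2 hU) (ne_of_mem_of_not_mem h1 hU)] at h5
    linarith
  · simp
  · simp

lemma sign_mono (f : ℝ → ℕ) (hf : Monotone f) (d e : ℝ) :
    ∃ ε : ℤ, (ε = 1 ∨ ε = -1) ∧ Monotone fun u : ℝ => ε * (f ((u - e) * d) : ℤ) := by
  rcases le_total 0 d with hd | hd
  · refine ⟨1, Or.inl rfl, fun u v h => ?_⟩
    have : f ((u - e) * d) ≤ f ((v - e) * d) := hf (by nlinarith)
    simp only [one_mul]; exact_mod_cast this
  · refine ⟨-1, Or.inr rfl, fun u v h => ?_⟩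
    have : f ((v - e) * d) ≤ f ((u - e) * d) := hf (by nlinarith)
    simp only; omega

/-- Combinatorial core. -/
lemma core (U Y D : Finset ℝ) (δ : ℝ) (hδ : δ ≠ 0) (hU : (0 : ℝ) ∉ U) (hY : (0 : ℝ) ∉ Y)
    (hD : (0 : ℝ) ∉ D) (h : ∀ u ∈ U, ∀ d ∈ D, (u - δ) * d ∈ Y) (s : ℕ) (hs : 0 < s) :
    D.card * E₂ U Y ≤
      (2 * (Y.card / s) + 1) * (D.card * (U.card * Y.card) + (Y.card * s) ^ 2) := by
  classical
  set f := cellIdx Y s with hf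
  set M := 2 * (Y.card / s) + 1 with hM
  set P := U ×ˢ Y with hP
  let k : ℝ × ℝ → ℝ := fun p => p.2 / p.1
  let c : ℝ → ℝ × ℝ → ℤ × ℤ := fun d p => ((f ((p.1 - δ) * d) : ℤ), (f p.2 : ℤ))
  let S : ℝ → Finset ((ℝ × ℝ) × (ℝ × ℝ)) := fun d =>
    (P ×ˢ P).filter (fun z => k z.1 = k z.2 ∧ c d z.1 = c d z.2)
  let T : ℝ → Finset ((ℝ × ℝ) × (ℝ × ℝ)) := fun d => (S d).filter (fun z => z.1 ≠ z.2)
  have hlow : ∀ d, E₂ U Y ≤ M * (S d).card := by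
    intro d
    rw [E₂_eq U Y hU]
    apply refine_pairs P k (c d) M
    intro x _
    obtain ⟨e₁, he₁, m₁⟩ := sign_mono f (cellIdx_mono Y s) d δ
    obtain ⟨e₂, he₂, m₂⟩ := sign_mono f (cellIdx_mono Y s) x 0
    have hb : ∀ y, (0:ℤ) ≤ (f y : ℤ) ∧ (f y : ℤ) ≤ ((Y.card / s : ℕ) : ℤ) := fun y =>
      ⟨by positivity, by exact_mod_cast cellIdx_le Y s y⟩
    have := chain_image U (fun u => (f ((u - δ) * d) : ℤ)) (fun u => (f ((u - 0) * x) : ℤ))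
      (Y.card / s) e₁ e₂ he₁ he₂ m₁ m₂ (fun u => hb _) (fun u => hb _)
    refine le_trans (Finset.card_le_card ?_) this
    intro z hz
    simp only [mem_image, mem_filter, hP, mem_product] at hz ⊢
    obtain ⟨⟨u, y⟩, ⟨⟨hu, hy⟩, hk⟩, rfl⟩ := hz
    refine ⟨u, hu, ?_⟩
    have hu0 : u ≠ 0 := ne_of_mem_of_not_mem hu hU
    have : (u - 0) * x = y := by
      rw [← hk]; simp only [k]; field_simp; ring
    simp only [c, this]
  have hST : ∀ d, (S d).card ≤ U.card * Y.card + (T d).card := by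
    intro d
    rw [← Finset.card_filter_add_card_filter_not (s := S d) (fun z => z.1 = z.2)]
    refine Nat.add_le_add ?_ le_rfl
    rw [← Finset.card_product]
    apply Finset.card_le_card_of_injOn (fun z => z.1)
    · rintro ⟨a, b⟩ hz
      simp only [S, coe_filter, mem_filter, mem_product, Set.mem_ofPred_eq] at hz
      exact hz.1.1.1
    · rintro ⟨a, b⟩ hz ⟨a', b'⟩ hz' hh
      simp only [coe_filter, Set.mem_ofPred_eq] at hz hz' hh
      rw [← hz.2, ← hz'.2, hh]
  have hT : ∑ d ∈ D, (T d).card ≤ (Y.card * s) ^ 2 := by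
    rw [← Finset.card_sigma]
    set W := (Y ×ˢ Y).filter (fun z => cellIdx Y s z.1 = cellIdx Y s z.2) with hW
    have hWc : W.card ≤ Y.card * s := cell_pairs Y s hs
    calc (D.sigma T).card ≤ (W ×ˢ W).card := by
          apply Finset.card_le_card_of_injOn
            (fun q => (((q.2.1.1 - δ) * q.1, (q.2.2.1 - δ) * q.1), (q.2.1.2, q.2.2.2)))
          · rintro ⟨d, ⟨u, y⟩, ⟨u', y'⟩⟩ hq
            simp only [coe_sigma, Set.mem_sigma_iff, mem_coe, T, S, c, mem_filter, hP,
              mem_product, Prod.mk.injEq, Nat.cast_inj] at hq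
            obtain ⟨hd, ⟨⟨⟨hu, hy⟩, hu', hy'⟩, -, h1, h2⟩, -⟩ := hq
            simp only [hW, coe_product, Set.mem_prod, mem_coe, mem_filter, mem_product]
            exact ⟨⟨⟨h _ hu _ hd, h _ hu' _ hd⟩, h1⟩, ⟨hy, hy'⟩, h2⟩
          · rintro ⟨d, ⟨u, y⟩, ⟨u', y'⟩⟩ hq ⟨e, ⟨v, w⟩, ⟨v', w'⟩⟩ hr hqr
            simp only [coe_sigma, Set.mem_sigma_iff, mem_coe, T, S, k, mem_filter, hP,
              mem_product, ne_eq] at hq hr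
            obtain ⟨hd, ⟨⟨⟨hu, hy⟩, hu', hy'⟩, hk, -⟩, hne⟩ := hq
            obtain ⟨he, ⟨⟨⟨hv, hw⟩, hv', hw'⟩, hl, -⟩, -⟩ := hr
            simp only [Prod.mk.injEq] at hqr
            obtain ⟨⟨p1, p2⟩, rfl, rfl⟩ := hqr
            have hd0 : d ≠ 0 := ne_of_mem_of_not_mem hd hD
            have he0 : e ≠ 0 := ne_of_mem_of_not_mem he hD
            have hu0 : u ≠ 0 := ne_of_mem_of_not_mem hu hU
            have hu0' : u' ≠ 0 := ne_of_mem_of_not_mem hu' hU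
            have hv0 : v ≠ 0 := ne_of_mem_of_not_mem hv hU
            have hv0' : v' ≠ 0 := ne_of_mem_of_not_mem hv' hU
            have hy0 : y ≠ 0 := ne_of_mem_of_not_mem hy hY
            have hyy : y ≠ y' := by
              rintro rfl
              apply hne
              rw [div_eq_div_iff hu0 hu0'] at hk
              have := mul_left_cancel₀ hy0 hk
              rw [this]
            rw [div_eq_div_iff hu0 hu0'] at hk
            rw [div_eq_div_iff hv0 hv0'] at hl
            have hde : d = e := by
              have h3 : (y - y') * δ * (d - e) = 0 := by
                linear_combination d * hk - e * hl + y' * p1 - y * p2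
              have h4 : d - e = 0 := by
                have := mul_ne_zero (sub_ne_zero.2 hyy) hδ
                exact (mul_eq_zero.1 h3).resolve_left this
              linarith
            subst hde
            have q1 := mul_right_cancel₀ hd0 p1
            have q2 := mul_right_cancel₀ hd0 p2
            have q3 : u = v := by linarith
            have q4 : u' = v' := by linarith
            rw [q3, q4]
      _ = W.card ^ 2 := by rw [Finset.card_product, sq]
      _ ≤ _ := Nat.pow_le_pow_left hWc 2
  calc D.card * E₂ U Y = ∑ d ∈ D, E₂ U Y := by rw [Finset.sum_const, smul_eq_mul]
    _ ≤ ∑ d ∈ D, M * (U.card * Y.card + (T d).card) :=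
        Finset.sum_le_sum fun d _ => (hlow d).trans (Nat.mul_le_mul_left _ (hST d))
    _ = M * (D.card * (U.card * Y.card) + ∑ d ∈ D, (T d).card) := by
        rw [← Finset.mul_sum, Finset.sum_add_distrib, Finset.sum_const, smul_eq_mul]
    _ ≤ _ := Nat.mul_le_mul_left _ (Nat.add_le_add_left hT _)

lemma final_bound (U Y D : Finset ℝ) (δ : ℝ) (hδ : δ ≠ 0) (hU : (0 : ℝ) ∉ U) (hY : (0 : ℝ) ∉ Y)
    (hD : (0 : ℝ) ∉ D) (h : ∀ u ∈ U, ∀ d ∈ D, (u - δ) * d ∈ Y) (n : ℕ) (hn : 0 < n)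
    (hUn : U.card = n) (hDn : D.card = n) (h1 : n ≤ Y.card) (h2 : Y.card ≤ n ^ 2) :
    (E₂ U Y : ℝ) ≤ 9 * (Y.card : ℝ) ^ ((5 : ℝ) / 2) := by
  set N := Y.card with hN
  set w := Real.sqrt N with hw
  have hN1 : (1 : ℝ) ≤ N := by exact_mod_cast hn.trans_le h1
  have hw1 : 1 ≤ w := Real.one_le_sqrt.2 hN1
  have hww : w ^ 2 = N := Real.sq_sqrt (by positivity)
  have hn0 : (0 : ℝ) < n := by exact_mod_cast hn
  have hwn : w ≤ n := by
    rw [hw, Real.sqrt_le_left hn0.le]; exact_mod_cast h2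
  set s := ⌈(n : ℝ) / w⌉₊ with hs
  have hs0 : 0 < s := Nat.ceil_pos.2 (by positivity)
  have hs1 : (n : ℝ) ≤ s * w := by
    have := Nat.le_ceil ((n : ℝ) / w)
    rwa [div_le_iff₀ (by linarith)] at this
  have hs2 : (s : ℝ) * w ≤ 2 * n := by
    have := (Nat.ceil_lt_add_one (a := (n : ℝ) / w) (by positivity)).le
    have h3 : (s : ℝ) * w ≤ (n / w + 1) * w := by gcongr
    have h4 : ((n : ℝ) / w + 1) * w = n + w := by field_simp
    linarith
  have hsN : s ≤ N := by
    refine le_trans (Nat.ceil_le.2 ?_) h1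
    exact div_le_self hn0.le hw1
  have hc := core U Y D δ hδ hU hY hD h s hs0
  rw [hUn, hDn, ← hN] at hc
  have hMs : (2 * (N / s) + 1) * s ≤ 3 * N := by
    have := Nat.div_mul_le_self N s
    nlinarith
  have hc2 : s * (n * E₂ U Y) ≤ (3 * N) * (n * (n * N) + (N * s) ^ 2) := by
    calc s * (n * E₂ U Y) ≤ s * ((2 * (N / s) + 1) * (n * (n * N) + (N * s) ^ 2)) :=
          Nat.mul_le_mul_left _ hc
      _ = ((2 * (N / s) + 1) * s) * (n * (n * N) + (N * s) ^ 2) := by ring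
      _ ≤ _ := Nat.mul_le_mul_right _ hMs
  have hc3 : (s : ℝ) * (n * E₂ U Y) ≤ (3 * N) * (n * (n * N) + (N * s) ^ 2) := by
    exact_mod_cast hc2
  have hpow : (N : ℝ) ^ ((5 : ℝ) / 2) = w ^ 5 := by
    rw [← hww, ← Real.rpow_natCast, ← Real.rpow_mul (by linarith), ← Real.rpow_natCast]
    norm_num
  rw [hpow]
  rw [← hww] at hc3
  have hsr : (0 : ℝ) < s := by exact_mod_cast hs0
  have a1 : w ^ 4 * (n * n) ≤ w ^ 4 * (n * (s * w)) := by gcongr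
  have a2 : w ^ 5 * s * (s * w) ≤ w ^ 5 * s * (2 * n) := by gcongr
  have : (s * n : ℝ) * E₂ U Y ≤ (s * n : ℝ) * (9 * w ^ 5) := by nlinarith
  exact le_of_mul_le_mul_left this (by positivity)

theorem stmt16 :
    ∃ C : ℝ, 0 < C ∧ ∀ A : Finset ℝ,
      (0 : ℝ) ∉ A → (1 : ℝ) ∉ A → (-1 : ℝ) ∉ A →
      (E₂ A (Finset.image₂ (fun a b => a * (b + 1)) A A) : ℝ) ≤
          C * ((Finset.image₂ (fun a b => a * (b + 1)) A A).card : ℝ) ^ ((5 : ℝ) / 2) ∧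
      (E₂ (A.image (· + 1)) (Finset.image₂ (fun a b => a * (b + 1)) A A) : ℝ) ≤
          C * ((Finset.image₂ (fun a b => a * (b + 1)) A A).card : ℝ) ^ ((5 : ℝ) / 2) := by
  refine ⟨9, by norm_num, fun A h0 _ hm => ?_⟩
  rcases A.eq_empty_or_nonempty with rfl | hA
  · simp [E₂]
  set Y := Finset.image₂ (fun a b => a * (b + 1)) A A with hY
  have hmem : ∀ a ∈ A, ∀ b ∈ A, a * (b + 1) ∈ Y := fun a ha b hb =>
    Finset.mem_image₂_of_mem (f := fun a b : ℝ => a * (b + 1)) ha hb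
  have hb1 : ∀ b ∈ A, b + 1 ≠ 0 := fun b hb hb0 => hm (by
    have : b = -1 := by linarith
    rwa [← this])
  have hY0 : (0 : ℝ) ∉ Y := by
    rw [hY, Finset.mem_image₂]
    rintro ⟨a, ha, b, hb, hab⟩
    rcases mul_eq_zero.1 hab with h | h
    · exact h0 (h ▸ ha)
    · exact hb1 b hb h
  have hn : 0 < A.card := hA.card_pos
  have h1 : A.card ≤ Y.card := by
    obtain ⟨b, hb⟩ := hA
    apply Finset.card_le_card_of_injOn (fun a => a * (b + 1))
    · intro a ha
      exact hmem a ha b hb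
    · intro a _ a' _ h
      exact mul_right_cancel₀ (hb1 b hb) h
  have h2 : Y.card ≤ A.card ^ 2 := by
    rw [sq]; exact Finset.card_image₂_le _ _ _
  have hcard : (A.image (· + 1)).card = A.card :=
    Finset.card_image_of_injective _ (add_left_injective 1)
  have hA1 : (0 : ℝ) ∉ A.image (· + 1) := by
    rw [Finset.mem_image]
    rintro ⟨b, hb, h⟩
    exact hb1 b hb h
  constructor
  · refine final_bound A Y A (-1) (by norm_num) h0 hY0 h0 ?_ A.card hn rfl rfl h1 h2
    intro u hu d hd
    have := hmem d hd u hu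
    rwa [show (u - -1) * d = d * (u + 1) by ring]
  · refine final_bound _ Y (A.image (· + 1)) 1 (by norm_num) hA1 hY0 hA1 ?_ A.card hn hcard hcard
      h1 h2
    intro u hu d hd
    obtain ⟨a, ha, rfl⟩ := Finset.mem_image.1 hu
    obtain ⟨b, hb, rfl⟩ := Finset.mem_image.1 hd
    have := hmem a ha b hb
    rwa [show (a + 1 - 1) * (b + 1) = a * (b + 1) by ring]
end
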